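/- Let φ, m ∈ C_0^∞(ℝ^{2d}) with φ real-valued and let a, b ≥ 0. Assume that the 2d×2d Hessian Hess φ is invertible and the vector (∇_η − ∇_ξ)φ is non-vanishing at every point of supp m. Then there exists a constant C such that for all λ with |λ| ≥ 1 and all Schwartz functions f, g on ℝ^d, ‖B_λ(f,g)‖_{L^∞(⟨x⟩^a)} ≤ C |λ|^{−d−b} ‖f‖_{L^1(⟨x⟩^{a+b})} ‖g‖_{L^1(⟨x⟩^{a+b})}. -/

import Mathlib

open MeasureTheory Filter Complex SchwartzMap
open scoped RealInnerProductSpace ENNReal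

noncomputable section

/-- Euclidean space `ℝ^d`. -/
abbrev E (d : ℕ) : Type := EuclideanSpace ℝ (Fin d)

/-- The Fourier transform `(2π)^{-d/2} ∫ e^{-i x·ξ} f(x) dx`. -/
def FT {d : ℕ} (f : E d → ℂ) (ξ : E d) : ℂ :=
  (((2 * Real.pi) ^ (-(d : ℝ) / 2) : ℝ) : ℂ) *
    ∫ x : E d, Complex.exp (-(Complex.I * ((⟪x, ξ⟫ : ℝ) : ℂ))) * f x

/-- The bilinear oscillatory integral `B_λ(f,g)` with symbol `m` and phase `φ`. -/
def Bop {d : ℕ} (m : E d × E d → ℂ) (φ : E d × E d → ℝ) (lam : ℝ)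
    (f g : 𝓢(E d, ℂ)) (x : E d) : ℂ :=
  (((2 * Real.pi) ^ (-(d : ℝ) / 2) : ℝ) : ℂ) *
    ∫ p : E d × E d,
      Complex.exp (Complex.I * ((⟪x, p.1 + p.2⟫ + lam * φ p : ℝ) : ℂ)) *
        m p * FT (⇑f) p.1 * FT (⇑g) p.2

/-- Standard basis vector of `ℝ^d`. -/
def ev {d : ℕ} (i : Fin d) : E d := EuclideanSpace.single i 1

/-- The direction corresponding to `∂_{η_i}`. -/
def etaV {d : ℕ} (i : Fin d) : E d × E d := (ev i, 0)

/-- The direction corresponding to `∂_{ξ_i}`. -/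
def xiV {d : ℕ} (i : Fin d) : E d × E d := (0, ev i)

/-- Iterated (second) directional derivative: first in direction `u`, then in direction `v`. -/
def D2 {V : Type*} [NormedAddCommGroup V] [NormedSpace ℝ V]
    (φ : V → ℝ) (x u v : V) : ℝ :=
  fderiv ℝ (fun y => fderiv ℝ φ y u) x v

/-- The full `2d × 2d` Hessian matrix of `φ` at `x` in the variables `(η,ξ)`. -/
def hessMat {d : ℕ} (φ : E d × E d → ℝ) (x : E d × E d) :
    Matrix (Fin d ⊕ Fin d) (Fin d ⊕ Fin d) ℝ :=
  Matrix.of fun i j => D2 φ x (Sum.elim etaV xiV j) (Sum.elim etaV xiV i)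

/-- The `d × d` matrix `(A_i B_j φ)_{i,j}` for families of first-order directions `A`, `B`. -/
def derMat {d : ℕ} (φ : E d × E d → ℝ) (x : E d × E d)
    (A B : Fin d → E d × E d) : Matrix (Fin d) (Fin d) ℝ :=
  Matrix.of fun i j => D2 φ x (B j) (A i)

/-- Weighted Lebesgue norm `‖f‖_{L^p(⟨x⟩^a)} = ‖x ↦ ⟨x⟩^a f(x)‖_{L^p}`. -/
def wLpNorm {d : ℕ} (p : ℝ≥0∞) (a : ℝ) (f : E d → ℂ) : ℝ≥0∞ :=
  eLpNorm (fun x => (((1 + ‖x‖ ^ 2) ^ (a / 2) : ℝ) : ℂ) * f x) p volume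

section BFsec
variable {V : Type*} [NormedAddCommGroup V] [NormedSpace ℝ V]
variable {W : Type*} [NormedAddCommGroup W] [NormedSpace ℝ W]
variable {ι : Type*}

/-- A family of smooth functions all of whose derivatives are bounded uniformly in the family. -/
def BF (F : ι → V → W) : Prop :=
  (∀ i, ContDiff ℝ (⊤ : ℕ∞) (F i)) ∧
    ∀ k : ℕ, ∃ C : ℝ, 0 ≤ C ∧ ∀ i x, ‖iteratedFDeriv ℝ k (F i) x‖ ≤ C

lemma natCast_le_top' (k : ℕ) : (k : WithTop ℕ∞) ≤ ((⊤ : ℕ∞) : WithTop ℕ∞) := by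
  exact_mod_cast le_top

lemma BF.reindex {κ : Type*} {F : ι → V → W} (hF : BF F) (s : κ → ι) : BF (fun k => F (s k)) :=
  ⟨fun i => hF.1 _, fun k => by
    obtain ⟨C, h0, hC⟩ := hF.2 k
    exact ⟨C, h0, fun i x => hC _ x⟩⟩

lemma BF.bound {F : ι → V → W} (hF : BF F) : ∃ C : ℝ, 0 ≤ C ∧ ∀ i x, ‖F i x‖ ≤ C := by
  obtain ⟨C, h0, hC⟩ := hF.2 0
  exact ⟨C, h0, fun i x => by simpa using hC i x⟩

lemma BF.const {c : ι → W} (C : ℝ) (hc : ∀ i, ‖c i‖ ≤ C) : BF (fun i (_ : V) => c i) := by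
  refine ⟨fun i => contDiff_const, fun k => ⟨max C 0, le_max_right _ _, fun i x => ?_⟩⟩
  rcases Nat.eq_zero_or_pos k with rfl | hk
  · simpa using Or.inl (hc i)
  · rw [iteratedFDeriv_const_of_ne hk.ne']
    simp

lemma BF.of_compact {f : V → W} (hf : ContDiff ℝ (⊤ : ℕ∞) f) (hc : HasCompactSupport f) :
    BF (fun _ : ι => f) := by
  refine ⟨fun i => hf, fun k => ?_⟩
  obtain ⟨C, hC⟩ := (hf.continuous_iteratedFDeriv (natCast_le_top' k)).bounded_above_of_compact_support
    (hc.iteratedFDeriv k)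
  exact ⟨max C 0, le_max_right _ _, fun i x => (hC x).trans (le_max_left _ _)⟩

lemma BF.translate {f : V → W} (hf : BF (fun _ : Unit => f)) (t : ι → V) :
    BF (fun i x => f (x + t i)) := by
  refine ⟨fun i => (hf.1 ()).comp (contDiff_id.add contDiff_const), fun k => ?_⟩
  obtain ⟨C, h0, hC⟩ := hf.2 k
  refine ⟨C, h0, fun i x => ?_⟩
  rw [iteratedFDeriv_comp_add_right]
  exact hC () _

lemma BF.diffquot {f : V → W} (hf : BF (fun _ : Unit => f)) :
    BF (fun (h : V) x => ‖h‖⁻¹ • (f (x + h) - f x)) := by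
  have h1 : ∀ h : V, ContDiff ℝ (⊤ : ℕ∞) (fun x => f (x + h)) := fun h =>
    (hf.1 ()).comp (contDiff_id.add contDiff_const)
  refine ⟨fun h => ((h1 h).sub (hf.1 ())).const_smul _, fun k => ?_⟩
  obtain ⟨C, h0, hC⟩ := hf.2 (k + 1)
  refine ⟨C, h0, fun h x => ?_⟩
  have hk : ∀ {g : V → W}, ContDiff ℝ (⊤ : ℕ∞) g → ContDiff ℝ k g :=
    fun hg => hg.of_le (natCast_le_top' k)
  rw [iteratedFDeriv_const_smul_apply' (((hk (h1 h)).sub (hk (hf.1 ()))).contDiffAt)]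
  rw [fun_iteratedFDeriv_sub_apply (hk (h1 h)).contDiffAt (hk (hf.1 ())).contDiffAt,
    iteratedFDeriv_comp_add_right]
  have hd : ‖iteratedFDeriv ℝ k f (x + h) - iteratedFDeriv ℝ k f x‖ ≤ C * ‖(x + h) - x‖ := by
    apply Convex.norm_image_sub_le_of_norm_fderiv_le (𝕜 := ℝ) (s := Set.univ)
    · intro y _
      exact (ContDiff.differentiable_iteratedFDeriv (m := k)
        (by exact_mod_cast (WithTop.coe_lt_top k)) (hf.1 ())) y
    · intro y _
      rw [norm_fderiv_iteratedFDeriv]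
      exact hC () y
    · exact convex_univ
    · trivial
    · trivial
  rw [norm_smul, norm_inv, norm_norm]
  rw [add_sub_cancel_left] at hd
  rcases eq_or_ne h 0 with rfl | hh
  · simpa using h0
  · have : 0 < ‖h‖ := norm_pos_iff.2 hh
    rw [inv_mul_le_iff₀ this, mul_comm]
    exact hd

lemma BF.clm {W' : Type*} [NormedAddCommGroup W'] [NormedSpace ℝ W'] {F : ι → V → W}
    (hF : BF F) (L : W →L[ℝ] W') : BF (fun i x => L (F i x)) := by
  refine ⟨fun i => L.contDiff.comp (hF.1 i), fun k => ?_⟩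
  obtain ⟨C, h0, hC⟩ := hF.2 k
  refine ⟨‖L‖ * C, by positivity, fun i x => ?_⟩
  refine (L.norm_iteratedFDeriv_comp_left (hF.1 i).contDiffAt (natCast_le_top' k)).trans ?_
  gcongr
  exact hC i x

lemma BF.dir {F : ι → V → W} (hF : BF F) (v : V) : BF (fun i x => fderiv ℝ (F i) x v) := by
  have : BF (fun i x => fderiv ℝ (F i) x) := by
    refine ⟨fun i => (hF.1 i).fderiv_right (by simp), fun k => ?_⟩
    obtain ⟨C, h0, hC⟩ := hF.2 (k + 1)
    refine ⟨C, h0, fun i x => ?_⟩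
    have := norm_iteratedFDeriv_fderiv (𝕜 := ℝ) (f := F i) (x := x) (n := k)
    exact this.trans_le (hC i x)
  exact this.clm (ContinuousLinearMap.apply ℝ W v)

lemma BF.add {F G : ι → V → W} (hF : BF F) (hG : BF G) : BF (fun i x => F i x + G i x) := by
  refine ⟨fun i => (hF.1 i).add (hG.1 i), fun k => ?_⟩
  obtain ⟨C, h0, hC⟩ := hF.2 k
  obtain ⟨D, h0', hD⟩ := hG.2 k
  refine ⟨C + D, by positivity, fun i x => ?_⟩
  rw [fun_iteratedFDeriv_add_apply ((hF.1 i).of_le (natCast_le_top' k)).contDiffAt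
    ((hG.1 i).of_le (natCast_le_top' k)).contDiffAt]
  exact (norm_add_le _ _).trans (add_le_add (hC i x) (hD i x))

lemma BF.sum {J : Type*} (s : Finset J) {F : J → ι → V → W} (hF : ∀ j, BF (F j)) :
    BF (fun i x => ∑ j ∈ s, F j i x) := by
  classical
  induction s using Finset.induction_on with
  | empty => simpa using BF.const (V := V) (c := fun _ : ι => (0 : W)) 0 (by simp)
  | insert a s ha ih =>
    simp only [Finset.sum_insert ha]
    exact (hF a).add ih

lemma BF.mul {A : Type*} [NormedRing A] [NormedAlgebra ℝ A] {F G : ι → V → A}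
    (hF : BF F) (hG : BF G) : BF (fun i x => F i x * G i x) := by
  refine ⟨fun i => (hF.1 i).mul (hG.1 i), fun k => ?_⟩
  choose C h0 hC using hF.2
  choose D h0' hD using hG.2
  refine ⟨∑ i ∈ Finset.range (k + 1), (k.choose i : ℝ) * C i * D (k - i),
    Finset.sum_nonneg fun j _ => by have := h0 j; have := h0' (k - j); positivity, fun i x => ?_⟩
  refine (norm_iteratedFDeriv_mul_le (hF.1 i) (hG.1 i) x (natCast_le_top' k)).trans ?_
  refine Finset.sum_le_sum fun j _ => ?_
  have := h0 j
  gcongr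
  · exact hC j i x
  · exact hD _ i x

lemma BF.comp_real {F : ι → V → ℝ} (hF : BF F) {G : ℝ → ℝ} (hG : ContDiff ℝ (⊤ : ℕ∞) G) :
    BF (fun i x => G (F i x)) := by
  refine ⟨fun i => hG.comp (hF.1 i), fun k => ?_⟩
  choose C h0 hC using hF.2
  have hb : ∀ j : ℕ, ∃ D : ℝ, ∀ t ∈ Set.Icc (-C 0) (C 0), ‖iteratedFDeriv ℝ j G t‖ ≤ D := fun j =>
    isCompact_Icc.exists_bound_of_continuousOn
      (hG.continuous_iteratedFDeriv (natCast_le_top' j)).continuousOn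
  choose D hD using hb
  set D' : ℝ := ∑ j ∈ Finset.range (k + 1), |D j|
  set C' : ℝ := 1 + ∑ j ∈ Finset.range (k + 1), C j
  have hC'1 : 1 ≤ C' := by
    have : 0 ≤ ∑ j ∈ Finset.range (k + 1), C j := Finset.sum_nonneg fun j _ => h0 j
    simp only [C']; linarith
  have hD'0 : 0 ≤ D' := Finset.sum_nonneg fun j _ => abs_nonneg _
  refine ⟨k.factorial * D' * C' ^ k, by positivity, fun i x => ?_⟩
  refine norm_iteratedFDeriv_comp_le hG (hF.1 i) (natCast_le_top' k) x ?_ ?_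
  · intro j hj
    have hx : F i x ∈ Set.Icc (-C 0) (C 0) := by
      have := hC 0 i x
      rw [norm_iteratedFDeriv_zero, Real.norm_eq_abs, abs_le] at this
      exact this
    refine ((hD j _ hx).trans (le_abs_self _)).trans ?_
    exact Finset.single_le_sum (f := fun j => |D j|) (fun j _ => abs_nonneg _)
      (Finset.mem_range.2 (by omega))
  · intro j hj1 hj
    refine (hC j i x).trans ?_
    have h1 : C j ≤ C' := by
      have := Finset.single_le_sum (f := C) (fun j _ => h0 j)
        (Finset.mem_range.2 (show j < k + 1 by omega))
      simp only [C']; linarith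
    exact h1.trans (le_self_pow₀ hC'1 (by omega))

end BFsec

/-- A smooth function agreeing with the inverse on `[c, ∞)`. -/
lemma exists_smooth_inv {c : ℝ} (hc : 0 < c) :
    ∃ G : ℝ → ℝ, ContDiff ℝ (⊤ : ℕ∞) G ∧ ∀ t, c ≤ t → G t * t = 1 := by
  refine ⟨fun t => Real.smoothTransition (t * (2 / c) - 1) / t, ?_, ?_⟩
  · have hs : ContDiff ℝ (⊤ : ℕ∞) (fun t : ℝ => Real.smoothTransition (t * (2 / c) - 1)) :=
      Real.smoothTransition.contDiff.comp ((contDiff_id.mul contDiff_const).sub contDiff_const)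
    rw [contDiff_iff_contDiffAt]
    intro t
    by_cases ht : t < c / 2
    · have : (fun t : ℝ => Real.smoothTransition (t * (2 / c) - 1) / t) =ᶠ[nhds t] fun _ => 0 := by
        filter_upwards [Iio_mem_nhds ht] with s hs
        rw [Real.smoothTransition.zero_of_nonpos, zero_div]
        have hs' : s < c / 2 := hs
        have : s * (2 / c) ≤ c / 2 * (2 / c) := by gcongr
        have h2 : c / 2 * (2 / c) = 1 := by field_simp
        linarith
      exact contDiffAt_const.congr_of_eventuallyEq this
    · exact hs.contDiffAt.div contDiffAt_id (by
        have : 0 < c / 2 := by positivity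
        intro h0; have h1 : t = 0 := h0; linarith)
  · intro t ht
    have ht0 : 0 < t := hc.trans_le ht
    show Real.smoothTransition (t * (2 / c) - 1) / t * t = 1
    rw [Real.smoothTransition.one_of_one_le]
    · field_simp
    · have : c * (2 / c) ≤ t * (2 / c) := by gcongr
      have h2 : c * (2 / c) = 2 := by field_simp
      linarith

set_option linter.unusedSectionVars false

section nonstat
variable {V : Type*} [NormedAddCommGroup V] [NormedSpace ℝ V] [FiniteDimensional ℝ V]
  [MeasurableSpace V] [BorelSpace V] (ν : Measure V) [ν.IsAddHaarMeasure]
variable {ι : Type*}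

lemma fderiv_osc {Ψ : V → ℝ} (hΨ : ContDiff ℝ (⊤ : ℕ∞) Ψ) (μ : ℝ) (x v : V) :
    fderiv ℝ (fun x => Complex.exp (Complex.I * ((μ * Ψ x : ℝ) : ℂ))) x v =
      Complex.exp (Complex.I * ((μ * Ψ x : ℝ) : ℂ)) *
        (Complex.I * μ * ((fderiv ℝ Ψ x v : ℝ) : ℂ)) := by
  have h1 : HasFDerivAt Ψ (fderiv ℝ Ψ x) x :=
    (hΨ.differentiable (by simp) x).hasFDerivAt
  have h2 : HasFDerivAt (fun x => ((μ * Ψ x : ℝ) : ℂ))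
      (Complex.ofRealCLM.comp (μ • fderiv ℝ Ψ x)) x :=
    Complex.ofRealCLM.hasFDerivAt.comp x (h1.const_mul μ)
  have h3 := (h2.const_mul Complex.I).cexp
  rw [h3.fderiv]
  simp
  ring

lemma contDiff_osc {Ψ : V → ℝ} (hΨ : ContDiff ℝ (⊤ : ℕ∞) Ψ) (μ : ℝ) :
    ContDiff ℝ (⊤ : ℕ∞) (fun x => Complex.exp (Complex.I * ((μ * Ψ x : ℝ) : ℂ))) := by
  have : ContDiff ℝ (⊤ : ℕ∞) (fun x => ((μ * Ψ x : ℝ) : ℂ)) :=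
    Complex.ofRealCLM.contDiff.comp (contDiff_const.mul hΨ)
  exact (contDiff_const.mul this).cexp

lemma norm_osc (t : ℝ) : ‖Complex.exp (Complex.I * (t : ℂ))‖ = 1 := by
  rw [mul_comm]; exact Complex.norm_exp_ofReal_mul_I t

/-- trivial bound -/
lemma osc_trivial (u : ι → V → ℂ) (hu : BF u) {K : Set V} (hK : IsCompact K)
    (hsupp : ∀ i, tsupport (u i) ⊆ K) :
    ∃ C : ℝ, 0 ≤ C ∧ ∀ i (θ : V → ℝ),
      ‖∫ x, Complex.exp (Complex.I * (θ x : ℂ)) * u i x ∂ν‖ ≤ C := by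
  obtain ⟨C, h0, hC⟩ := hu.bound
  refine ⟨C * ν.real K, by positivity, fun i θ => ?_⟩
  have : ∫ x, Complex.exp (Complex.I * (θ x : ℂ)) * u i x ∂ν =
      ∫ x in K, Complex.exp (Complex.I * (θ x : ℂ)) * u i x ∂ν := by
    symm
    apply setIntegral_eq_integral_of_forall_compl_eq_zero
    intro x hx
    rw [image_eq_zero_of_notMem_tsupport (fun h => hx (hsupp i h)), mul_zero]
  rw [this]
  apply norm_setIntegral_le_of_norm_le_const hK.measure_lt_top
  intro x _
  rw [norm_mul, norm_osc, one_mul]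
  exact hC i x

lemma tsupport_fderiv_apply_subset' (f : V → ℂ) (v : V) :
    tsupport (fun x => fderiv ℝ f x v) ⊆ tsupport f :=
  tsupport_fderiv_apply_subset ℝ v

/-- Nonstationary phase, uniform over bounded families. -/
theorem nonstat {J : Type*} [Fintype J] (b : J → V) (Ψ : ι → V → ℝ)
    (hΨ : ∀ i, ContDiff ℝ (⊤ : ℕ∞) (Ψ i))
    (hΨb : ∀ j, BF (fun i x => fderiv ℝ (Ψ i) x (b j)))
    {K : Set V} (hK : IsCompact K) {c : ℝ} (hc : 0 < c) (N : ℕ) :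
    ∀ u : ι → V → ℂ, BF u → (∀ i, tsupport (u i) ⊆ K) →
      (∀ i, ∀ x ∈ tsupport (u i), c ≤ ∑ j, (fderiv ℝ (Ψ i) x (b j)) ^ 2) →
      ∃ C : ℝ, 0 ≤ C ∧ ∀ i (μ : ℝ),
        |μ| ^ N * ‖∫ x, Complex.exp (Complex.I * ((μ * Ψ i x : ℝ) : ℂ)) * u i x ∂ν‖ ≤ C := by
  obtain ⟨G, hG, hGi⟩ := exists_smooth_inv hc
  induction N with
  | zero =>
    intro u hu hs _
    obtain ⟨C, h0, hC⟩ := osc_trivial ν u hu hK hs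
    exact ⟨C, h0, fun i μ => by simpa using hC i (fun x => μ * Ψ i x)⟩
  | succ N ih =>
    intro u hu hs hlow
    set w : J → ι → V → ℂ := fun j i x =>
      (((G (∑ j, (fderiv ℝ (Ψ i) x (b j)) ^ 2) * fderiv ℝ (Ψ i) x (b j) : ℝ)) : ℂ) * u i x with hw
    have hwBF : ∀ j, BF (w j) := by
      intro j
      refine BF.mul ?_ hu
      have h1 : BF (fun i x => ∑ j, (fderiv ℝ (Ψ i) x (b j)) ^ 2) := by
        simp only [pow_two]
        exact BF.sum _ (fun j => (hΨb j).mul (hΨb j))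
      exact ((h1.comp_real hG).mul (hΨb j)).clm Complex.ofRealCLM
    have hws : ∀ j i, tsupport (w j i) ⊆ tsupport (u i) := fun j i => tsupport_mul_subset_right
    have hwcs : ∀ j i, HasCompactSupport (w j i) := fun j i =>
      hK.of_isClosed_subset (isClosed_tsupport _) ((hws j i).trans (hs i))
    set u' : ι → V → ℂ := fun i x => ∑ j, fderiv ℝ (w j i) x (b j) with hu'
    have hu'BF : BF u' := BF.sum _ (fun j => (hwBF j).dir (b j))
    have hu's : ∀ i, tsupport (u' i) ⊆ tsupport (u i) := by
      intro i
      apply closure_minimal _ (isClosed_tsupport _)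
      intro x hx
      by_contra hxn
      apply hx
      apply Finset.sum_eq_zero
      intro j _
      have : x ∉ tsupport (fun x => fderiv ℝ (w j i) x (b j)) := fun h =>
        hxn (hws j i (tsupport_fderiv_apply_subset' _ _ h))
      exact image_eq_zero_of_notMem_tsupport (f := fun x => fderiv ℝ (w j i) x (b j)) this
    obtain ⟨C, h0, hC⟩ := ih u' hu'BF (fun i => (hu's i).trans (hs i))
      (fun i x hx => hlow i x (hu's i hx))
    refine ⟨C, h0, fun i μ => ?_⟩
    refine le_trans (le_of_eq ?_) (hC i μ)
    rw [pow_succ, mul_assoc]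
    congr 1
    rw [← Real.norm_eq_abs, ← Complex.norm_real, ← norm_mul]
    have hid : Complex.I * ((μ : ℂ) * ∫ x, Complex.exp (Complex.I * ((μ * Ψ i x : ℝ) : ℂ)) * u i x ∂ν) =
        - ∫ x, Complex.exp (Complex.I * ((μ * Ψ i x : ℝ) : ℂ)) * u' i x ∂ν := by
      set e : V → ℂ := fun x => Complex.exp (Complex.I * ((μ * Ψ i x : ℝ) : ℂ)) with he
      have heS : ContDiff ℝ (⊤ : ℕ∞) e := contDiff_osc (hΨ i) μ
      have hdc : ∀ (f : V → ℂ) (v : V), ContDiff ℝ (⊤ : ℕ∞) f →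
          Continuous (fun x => fderiv ℝ f x v) := fun f v hf =>
        (hf.continuous_fderiv (by simp)).clm_apply continuous_const
      have i1 : ∀ j, Integrable (fun x => fderiv ℝ e x (b j) * w j i x) ν := fun j =>
        ((hdc e _ heS).mul ((hwBF j).1 i).continuous).integrable_of_hasCompactSupport
          (hwcs j i).mul_left
      have i2 : ∀ j, Integrable (fun x => e x * fderiv ℝ (w j i) x (b j)) ν := fun j =>
        (heS.continuous.mul (hdc _ _ ((hwBF j).1 i))).integrable_of_hasCompactSupport
          ((hwcs j i).fderiv_apply ℝ (b j)).mul_left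
      have i3 : ∀ j, Integrable (fun x => e x * w j i x) ν := fun j =>
        (heS.continuous.mul ((hwBF j).1 i).continuous).integrable_of_hasCompactSupport
          (hwcs j i).mul_left
      have hibp : ∀ j, ∫ x, e x * fderiv ℝ (w j i) x (b j) ∂ν =
          - ∫ x, fderiv ℝ e x (b j) * w j i x ∂ν := fun j =>
        integral_mul_fderiv_eq_neg_fderiv_mul_of_integrable (i1 j) (i2 j) (i3 j)
          (fun x _ => heS.differentiable (by simp) x)
          (fun x _ => ((hwBF j).1 i).differentiable (by simp) x)
      have : ∫ x, e x * u' i x ∂ν = - ∫ x, ∑ j, fderiv ℝ e x (b j) * w j i x ∂ν := by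
        simp only [hu', Finset.mul_sum]
        rw [integral_finsetSum _ (fun j _ => i2 j), integral_finsetSum _ (fun j _ => i1 j),
          ← Finset.sum_neg_distrib]
        exact Finset.sum_congr rfl fun j _ => hibp j
      rw [this, neg_neg, ← mul_assoc, ← integral_const_mul]
      congr 1
      funext x
      simp only [he, fderiv_osc (hΨ i), hw]
      by_cases hx : x ∈ tsupport (u i)
      · have hone := hGi _ (hlow i x hx)
        set S := ∑ j, (fderiv ℝ (Ψ i) x (b j)) ^ 2 with hS
        have : ∑ j, Complex.exp (Complex.I * ((μ * Ψ i x : ℝ) : ℂ)) *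
            (Complex.I * μ * ((fderiv ℝ (Ψ i) x (b j) : ℝ) : ℂ)) *
            (((G S * fderiv ℝ (Ψ i) x (b j) : ℝ) : ℂ) * u i x) =
            Complex.exp (Complex.I * ((μ * Ψ i x : ℝ) : ℂ)) * (Complex.I * μ) * u i x *
              ((G S * S : ℝ) : ℂ) := by
          have hSc : (S : ℂ) = ∑ j, ((fderiv ℝ (Ψ i) x (b j) : ℝ) : ℂ) ^ 2 := by
            rw [hS]; push_cast; rfl
          rw [Complex.ofReal_mul (G S) S, hSc, Finset.mul_sum, Finset.mul_sum]
          refine Finset.sum_congr rfl fun j _ => ?_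
          push_cast
          ring
        rw [this, hone]
        push_cast
        ring
      · rw [image_eq_zero_of_notMem_tsupport hx]
        simp
    have := congrArg norm hid
    rwa [norm_mul, Complex.norm_I, one_mul, norm_neg] at this

end nonstat

section statphase
variable {V : Type*} [NormedAddCommGroup V] [NormedSpace ℝ V] [FiniteDimensional ℝ V]
  [MeasurableSpace V] [BorelSpace V] (ν : Measure V) [ν.IsAddHaarMeasure]

lemma autocorr {g : V → ℂ} (hg : Continuous g) (hgc : HasCompactSupport g) :
    ∫ h, ∫ p, g (p + h) * (starRingEnd ℂ) (g p) ∂ν ∂ν =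
      (∫ p, g p ∂ν) * (starRingEnd ℂ) (∫ p, g p ∂ν) := by
  have hcont : Continuous (Function.uncurry fun (h p : V) => g (p + h) * (starRingEnd ℂ) (g p)) := by
    have : Continuous fun q : V × V => g (q.2 + q.1) * (starRingEnd ℂ) (g q.2) :=
      (hg.comp (continuous_snd.add continuous_fst)).mul
        (Complex.continuous_conj.comp (hg.comp continuous_snd))
    exact this
  rw [integral_integral_swap_of_hasCompactSupport hcont]
  · have : ∀ p : V, ∫ h, g (p + h) * (starRingEnd ℂ) (g p) ∂ν =
        (∫ p, g p ∂ν) * (starRingEnd ℂ) (g p) := by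
      intro p
      rw [integral_mul_const, integral_add_left_eq_self (fun x => g x) p]
    simp only [this]
    rw [integral_const_mul, integral_conj]
  · have hc : IsCompact ((fun q : V × V => q.1 - q.2) '' (tsupport g ×ˢ tsupport g)) :=
      (IsCompact.prod hgc hgc).image (by fun_prop)
    apply HasCompactSupport.intro (IsCompact.prod hc hgc)
    rintro ⟨h, p⟩ hq
    by_contra hne
    apply hq
    simp only [Function.uncurry, mul_eq_zero, not_or] at hne
    have h1 : p + h ∈ tsupport g := subset_tsupport _ hne.1
    have h2 : p ∈ tsupport g := subset_tsupport _ (fun h0 => hne.2 (by rw [h0, map_zero]))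
    exact ⟨⟨(p + h, p), ⟨h1, h2⟩, by simp⟩, h2⟩

theorem statphase_local {J : Type*} [Fintype J] (b : J → V) {φ : V → ℝ} {m : V → ℂ}
    (hφs : ContDiff ℝ (⊤ : ℕ∞) φ) (hφc : HasCompactSupport φ)
    (hms : ContDiff ℝ (⊤ : ℕ∞) m) (hmc : HasCompactSupport m)
    {c : ℝ} (hc : 0 < c)
    (hlow : ∀ p ∈ tsupport m, ∀ q ∈ tsupport m,
      c * ‖q - p‖ ^ 2 ≤ ∑ j, (fderiv ℝ φ q (b j) - fderiv ℝ φ p (b j)) ^ 2) :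
    ∃ C : ℝ, 0 ≤ C ∧ ∀ lam : ℝ, lam ≠ 0 → ∀ ℓ : V →L[ℝ] ℝ,
      ‖∫ x, Complex.exp (Complex.I * ((lam * φ x + ℓ x : ℝ) : ℂ)) * m x ∂ν‖ ^ 2 ≤
        C * (|lam| ^ (Module.finrank ℝ V))⁻¹ := by
  set n := Module.finrank ℝ V with hn
  have hφ1 : BF (fun _ : Unit => φ) := BF.of_compact hφs hφc
  have hm1 : BF (fun _ : Unit => m) := BF.of_compact hms hmc
  set u : V → V → ℂ := fun h p => m (p + h) * (starRingEnd ℂ) (m p) with hu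
  have huBF : BF u := (hm1.translate (fun h : V => h)).mul
    ((BF.of_compact (ι := V) hms hmc).clm (Complex.conjCLE : ℂ →L[ℝ] ℂ))
  have hus : ∀ h, tsupport (u h) ⊆ tsupport m := by
    intro h
    apply closure_mono
    intro x hx
    simp only [hu, Function.mem_support, mul_ne_zero_iff] at hx
    exact fun h0 => hx.2 (by rw [h0, map_zero])
  have hus' : ∀ h, ∀ x ∈ tsupport (u h), x + h ∈ tsupport m := by
    intro h
    have hcl : IsClosed {x | x + h ∈ tsupport m} :=
      (isClosed_tsupport m).preimage (continuous_id.add continuous_const)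
    apply closure_minimal _ hcl
    intro x hx
    simp only [hu, Function.mem_support, mul_ne_zero_iff] at hx
    exact subset_tsupport _ hx.1
  set Ψ : V → V → ℝ := fun h p => ‖h‖⁻¹ • (φ (p + h) - φ p) with hΨ
  have hΨBF : BF Ψ := hφ1.diffquot
  have hfd : ∀ h p v, fderiv ℝ (Ψ h) p v = ‖h‖⁻¹ • (fderiv ℝ φ (p + h) v - fderiv ℝ φ p v) := by
    intro h p v
    have hd : Differentiable ℝ φ := hφs.differentiable (by simp)
    have h1 : HasFDerivAt (fun p => φ (p + h)) (fderiv ℝ φ (p + h)) p := by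
      have := (hd (p + h)).hasFDerivAt
      have h3 := this.comp p ((hasFDerivAt_id p).add_const h)
      simpa [Function.comp_def] using h3
    have h2 := (h1.sub (hd p).hasFDerivAt).const_smul (‖h‖⁻¹)
    have : fderiv ℝ (Ψ h) p = _ := h2.fderiv
    rw [this]
    simp
  obtain ⟨C0, hC00, hC0⟩ := osc_trivial ν u huBF hmc hus
  obtain ⟨C1, hC10, hC1⟩ := nonstat ν (ι := {h : V // h ≠ 0}) b (fun h => Ψ h)
    (fun h => hΨBF.1 h) (fun j => (hΨBF.dir (b j)).reindex _) hmc hc (n + 1)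
    (fun h => u h) (huBF.reindex _) (fun h => hus h) (by
      rintro ⟨h, hh⟩ x hx
      have h1 := hlow x (hus h hx) (x + h) (hus' h x hx)
      have hpos : 0 < ‖h‖ := norm_pos_iff.2 hh
      simp only [hfd, smul_eq_mul, mul_pow, ← Finset.mul_sum]
      rw [add_sub_cancel_left] at h1
      rw [inv_pow, le_inv_mul_iff₀ (by positivity), mul_comm]
      exact h1)
  set A : ℝ := 2 ^ n * (C0 + C1) with hA
  have hA0 : 0 ≤ A := by positivity
  set R : ℝ := ∫ x : V, (1 + ‖x‖) ^ (-((n : ℝ) + 1)) ∂ν with hR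
  have hRi : Integrable (fun x : V => (1 + ‖x‖) ^ (-((n : ℝ) + 1))) ν :=
    integrable_one_add_norm (by rw [← hn]; linarith)
  have hR0 : 0 ≤ R := integral_nonneg fun x => by positivity
  refine ⟨A * R, by positivity, fun lam hlam ℓ => ?_⟩
  set g : V → ℂ := fun x => Complex.exp (Complex.I * ((lam * φ x + ℓ x : ℝ) : ℂ)) * m x with hg
  have hgcont : Continuous g := by
    have h1 := hφs.continuous
    have h2 := hms.continuous
    have h3 := ℓ.continuous
    simp only [hg]
    fun_prop
  have hgc : HasCompactSupport g := hmc.mul_left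
  have hac := autocorr ν hgcont hgc
  have hJ : ∀ h, ∫ p, g (p + h) * (starRingEnd ℂ) (g p) ∂ν =
      Complex.exp (Complex.I * ((ℓ h : ℝ) : ℂ)) *
        ∫ p, Complex.exp (Complex.I * ((lam * (φ (p + h) - φ p) : ℝ) : ℂ)) * u h p ∂ν := by
    intro h
    rw [← integral_const_mul]
    congr 1
    funext p
    simp only [hg, hu, map_mul, ← Complex.exp_conj, Complex.conj_I, Complex.conj_ofReal]
    have : ∀ a1 a2 a3 a4 : ℂ, Complex.exp a1 * m (p + h) * (Complex.exp a2 * (starRingEnd ℂ) (m p)) =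
      Complex.exp (a1 + a2) * (m (p + h) * (starRingEnd ℂ) (m p)) := by
        intro a1 a2 a3 a4; rw [Complex.exp_add]; ring
    rw [this _ _ 0 0, ← mul_assoc (Complex.exp _) (Complex.exp _), ← Complex.exp_add]
    congr 2
    rw [map_add]
    push_cast
    ring
  have hJb : ∀ h, ‖∫ p, g (p + h) * (starRingEnd ℂ) (g p) ∂ν‖ ≤
      A * (1 + ‖lam • h‖) ^ (-((n : ℝ) + 1)) := by
    intro h
    rw [hJ, norm_mul, norm_osc, one_mul]
    set X := ‖∫ p, Complex.exp (Complex.I * ((lam * (φ (p + h) - φ p) : ℝ) : ℂ)) * u h p ∂ν‖ with hX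
    have e0 : X ≤ C0 := hC0 h (fun p => lam * (φ (p + h) - φ p))
    have e1 : ‖lam • h‖ ^ (n + 1) * X ≤ C1 := by
      rcases eq_or_ne h 0 with rfl | hh
      · simpa using hC10
      · have := hC1 ⟨h, hh⟩ (lam * ‖h‖)
        have hpos : ‖h‖ ≠ 0 := norm_ne_zero_iff.2 hh
        have e2 : ∀ p, lam * ‖h‖ * Ψ h p = lam * (φ (p + h) - φ p) := by
          intro p
          simp only [hΨ, smul_eq_mul]
          field_simp
        simp only [e2] at this
        rwa [abs_mul, abs_norm, ← Real.norm_eq_abs, ← norm_smul] at this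
    have hX0 : 0 ≤ X := norm_nonneg _
    have hpos : 0 < 1 + ‖lam • h‖ := by positivity
    rw [Real.rpow_neg hpos.le, ← div_eq_mul_inv, le_div_iff₀ (by positivity)]
    have e3 : (1 + ‖lam • h‖) ^ ((n : ℝ) + 1) = (1 + ‖lam • h‖) ^ (n + 1) := by
      rw [← Real.rpow_natCast]; push_cast; rfl
    rw [e3]
    have e4 := add_pow_le (zero_le_one) (norm_nonneg (lam • h)) (n + 1)
    rw [one_pow, Nat.add_sub_cancel] at e4
    calc X * (1 + ‖lam • h‖) ^ (n + 1) ≤ X * (2 ^ n * (1 + ‖lam • h‖ ^ (n + 1))) := by gcongr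
      _ = 2 ^ n * (X + ‖lam • h‖ ^ (n + 1) * X) := by ring
      _ ≤ A := by rw [hA]; gcongr
  have hnorm : ‖∫ x, g x ∂ν‖ ^ 2 = ‖∫ h, ∫ p, g (p + h) * (starRingEnd ℂ) (g p) ∂ν ∂ν‖ := by
    rw [hac, norm_mul, RCLike.norm_conj, pow_two]
  rw [hnorm]
  refine (norm_integral_le_of_norm_le ((hRi.comp_smul hlam).const_mul A)
    (Eventually.of_forall hJb)).trans ?_
  rw [integral_const_mul, Measure.integral_comp_smul ν
    (fun x : V => (1 + ‖x‖) ^ (-((n : ℝ) + 1))) lam, ← hR, ← hn, smul_eq_mul, abs_inv, abs_pow]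
  apply le_of_eq
  ring

theorem statphase {J : Type*} [Fintype J] (b : J → V) {φ : V → ℝ} {m : V → ℂ}
    (hφs : ContDiff ℝ (⊤ : ℕ∞) φ) (hφc : HasCompactSupport φ)
    (hms : ContDiff ℝ (⊤ : ℕ∞) m) (hmc : HasCompactSupport m)
    (hloc : ∀ p ∈ tsupport m, ∃ U : Set V, IsOpen U ∧ p ∈ U ∧ ∃ c : ℝ, 0 < c ∧
      ∀ p ∈ U, ∀ q ∈ U,
        c * ‖q - p‖ ^ 2 ≤ ∑ j, (fderiv ℝ φ q (b j) - fderiv ℝ φ p (b j)) ^ 2) :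
    ∃ C : ℝ, 0 ≤ C ∧ ∀ lam : ℝ, lam ≠ 0 → ∀ ℓ : V →L[ℝ] ℝ,
      ‖∫ x, Complex.exp (Complex.I * ((lam * φ x + ℓ x : ℝ) : ℂ)) * m x ∂ν‖ ≤
        C * Real.sqrt ((|lam| ^ (Module.finrank ℝ V))⁻¹) := by
  choose! U hUo hUp c hc hU using hloc
  obtain ⟨t, ht⟩ := hmc.elim_nhds_subcover' (fun p _ => U p)
    (fun p hp => (hUo p hp).mem_nhds (hUp p hp))
  obtain ⟨χ, hχ⟩ := SmoothPartitionOfUnity.exists_isSubordinate (modelWithCornersSelf ℝ V)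
    (isClosed_tsupport m) (fun i : t => U (i : tsupport m)) (fun i => hUo _ (i : tsupport m).2)
    (by
      intro x hx
      obtain ⟨i, hi, hxi⟩ := Set.mem_iUnion₂.1 (ht hx)
      exact Set.mem_iUnion.2 ⟨⟨i, hi⟩, hxi⟩)
  set M : t → V → ℂ := fun i x => ((χ i x : ℝ) : ℂ) * m x with hM
  have hMs : ∀ i, ContDiff ℝ (⊤ : ℕ∞) (M i) := fun i =>
    (Complex.ofRealCLM.contDiff.comp (χ i).contMDiff.contDiff).mul hms
  have hMc : ∀ i, HasCompactSupport (M i) := fun i => hmc.mul_left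
  have hMsub : ∀ i, tsupport (M i) ⊆ U (i : tsupport m) := by
    intro i
    refine Set.Subset.trans (closure_mono ?_) (hχ i)
    intro x hx h0
    apply hx
    simp only [hM]
    rw [h0]
    simp
  have hsum : ∀ x, m x = ∑ i, M i x := by
    intro x
    by_cases hx : x ∈ tsupport m
    · have h1 := χ.sum_eq_one hx
      rw [finsum_eq_sum_of_fintype] at h1
      simp only [hM]
      rw [← Finset.sum_mul, ← Complex.ofReal_sum, h1]
      simp
    · simp [hM, image_eq_zero_of_notMem_tsupport hx]
  have hex : ∀ i : t, ∃ C : ℝ, 0 ≤ C ∧ ∀ lam : ℝ, lam ≠ 0 → ∀ ℓ : V →L[ℝ] ℝ,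
      ‖∫ x, Complex.exp (Complex.I * ((lam * φ x + ℓ x : ℝ) : ℂ)) * M i x ∂ν‖ ^ 2 ≤
        C * (|lam| ^ (Module.finrank ℝ V))⁻¹ := fun i =>
    statphase_local ν b hφs hφc (hMs i) (hMc i) (hc _ (i : tsupport m).2)
      (fun p hp q hq => hU _ (i : tsupport m).2 p (hMsub i hp) q (hMsub i hq))
  choose C hC0 hC using hex
  refine ⟨∑ i, Real.sqrt (C i), Finset.sum_nonneg fun i _ => Real.sqrt_nonneg _,
    fun lam hlam ℓ => ?_⟩
  have hint : ∀ i, Integrable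
      (fun x => Complex.exp (Complex.I * ((lam * φ x + ℓ x : ℝ) : ℂ)) * M i x) ν := by
    intro i
    have h1 := hφs.continuous
    have h2 := (hMs i).continuous
    have h3 := ℓ.continuous
    exact Continuous.integrable_of_hasCompactSupport (by fun_prop) (hMc i).mul_left
  have : ∫ x, Complex.exp (Complex.I * ((lam * φ x + ℓ x : ℝ) : ℂ)) * m x ∂ν =
      ∑ i, ∫ x, Complex.exp (Complex.I * ((lam * φ x + ℓ x : ℝ) : ℂ)) * M i x ∂ν := by
    rw [← integral_finsetSum _ (fun i _ => hint i)]
    congr 1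
    funext x
    rw [hsum x, Finset.mul_sum]
  rw [this, Finset.sum_mul]
  refine norm_sum_le_of_le _ fun i _ => ?_
  rw [← Real.sqrt_mul (hC0 i)]
  exact Real.le_sqrt_of_sq_le (hC i lam hlam ℓ)

end statphase

section kern
variable {d : ℕ}

/-- the coordinate directions -/
def bv (j : Fin d ⊕ Fin d) : E d × E d := Sum.elim etaV xiV j

lemma bv_repr (v : E d × E d) :
    v = ∑ j, (Sum.elim (fun i => v.1 i) (fun i => v.2 i) j : ℝ) • bv j := by
  rw [Fintype.sum_sum_type]
  ext i
  · simp [bv, etaV, xiV, ev, Prod.fst_sum, Pi.single_apply]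
  · simp [bv, etaV, xiV, ev, Prod.snd_sum, Pi.single_apply]

lemma hess_local {φ : E d × E d → ℝ} (hφs : ContDiff ℝ (⊤ : ℕ∞) φ) (p : E d × E d)
    (hdet : (hessMat φ p).det ≠ 0) :
    ∃ U : Set (E d × E d), IsOpen U ∧ p ∈ U ∧ ∃ c : ℝ, 0 < c ∧
      ∀ p ∈ U, ∀ q ∈ U,
        c * ‖q - p‖ ^ 2 ≤ ∑ j, (fderiv ℝ φ q (bv j) - fderiv ℝ φ p (bv j)) ^ 2 := by
  have hdir : ∀ v, ContDiff ℝ (⊤ : ℕ∞) (fun x => fderiv ℝ φ x v) := fun v =>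
    (hφs.fderiv_right (m := (⊤ : ℕ∞)) (by simp)).clm_apply contDiff_const
  set F : E d × E d → (Fin d ⊕ Fin d → ℝ) := fun x j => fderiv ℝ φ x (bv j) with hF
  have hFs : ContDiff ℝ (⊤ : ℕ∞) F := contDiff_pi.2 fun j => hdir _
  set L := fderiv ℝ F p with hL
  have hLv : ∀ v j, L v j = D2 φ p (bv j) v := by
    intro v j
    have : L = ContinuousLinearMap.pi fun j => fderiv ℝ (fun x => fderiv ℝ φ x (bv j)) p :=
      fderiv_pi fun j => (hdir _).differentiable (by simp) p
    rw [this]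
    rfl
  have hker : LinearMap.ker (L : E d × E d →ₗ[ℝ] (Fin d ⊕ Fin d → ℝ)) = ⊥ := by
    rw [LinearMap.ker_eq_bot']
    intro v hv
    set co : Fin d ⊕ Fin d → ℝ := Sum.elim (fun i => v.1 i) (fun i => v.2 i) with hco
    have hvec : Matrix.vecMul co (hessMat φ p) = 0 := by
      funext j
      have h1 : L v j = 0 := congrFun hv j
      rw [bv_repr v, ← hco, map_sum, Finset.sum_apply] at h1
      have hLs : ∀ (r : ℝ) w, L (r • w) j = r * D2 φ p (bv j) w := by
        intro r w; rw [map_smul, Pi.smul_apply, hLv, smul_eq_mul]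
      simp only [hLs] at h1
      simpa [Matrix.vecMul, dotProduct, hessMat, bv] using h1
    have hco0 : co = 0 := Matrix.eq_zero_of_vecMul_eq_zero hdet hvec
    rw [bv_repr v, ← hco, hco0]
    simp
  obtain ⟨k, hk0, hk⟩ := LinearMap.exists_antilipschitzWith _ hker
  have hstrict : HasStrictFDerivAt F L p := hFs.contDiffAt.hasStrictFDerivAt (by simp)
  have hkr : (0 : ℝ) < k := hk0
  have hlo := hstrict.isLittleO.def (c := (2 * (k : ℝ))⁻¹) (by positivity)
  rw [nhds_prod_eq] at hlo
  obtain ⟨u, hu, hu'⟩ := (Filter.eventually_prod_self_iff (r := fun x y =>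
    ‖F x - F y - L (x - y)‖ ≤ (2 * (k : ℝ))⁻¹ * ‖x - y‖)).1 hlo
  obtain ⟨U, hUu, hUo, hpU⟩ := mem_nhds_iff.1 hu
  refine ⟨U, hUo, hpU, ((2 * (k : ℝ))⁻¹) ^ 2, by positivity, fun p1 hp1 q hq => ?_⟩
  have h1 := hu' q (hUu hq) p1 (hUu hp1)
  have h2 : ‖q - p1‖ ≤ k * ‖L (q - p1)‖ := by
    have := hk.le_mul_dist q p1
    rw [dist_eq_norm, dist_eq_norm] at this
    simpa [map_sub] using this
  have h3 : (2 * (k : ℝ))⁻¹ * ‖q - p1‖ ≤ ‖F q - F p1‖ := by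
    have h4 : ‖L (q - p1)‖ ≤ ‖F q - F p1‖ + (2 * (k : ℝ))⁻¹ * ‖q - p1‖ := by
      calc ‖L (q - p1)‖ = ‖(F q - F p1) - (F q - F p1 - L (q - p1))‖ := by congr 1; abel
        _ ≤ _ := (norm_sub_le _ _).trans (by gcongr)
    have h5 : (k : ℝ)⁻¹ * ‖q - p1‖ ≤ ‖L (q - p1)‖ := by
      rw [inv_mul_le_iff₀ hkr]; exact h2
    have h6 : (k : ℝ)⁻¹ = 2 * (2 * (k : ℝ))⁻¹ := by field_simp
    rw [h6] at h5
    linarith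
  have h7 : ‖F q - F p1‖ ^ 2 ≤ ∑ j, (fderiv ℝ φ q (bv j) - fderiv ℝ φ p1 (bv j)) ^ 2 := by
    have h8 : ‖F q - F p1‖ ≤ Real.sqrt (∑ j, (fderiv ℝ φ q (bv j) - fderiv ℝ φ p1 (bv j)) ^ 2) := by
      rw [pi_norm_le_iff_of_nonneg (Real.sqrt_nonneg _)]
      intro j
      rw [Real.norm_eq_abs, ← Real.sqrt_sq_eq_abs]
      apply Real.sqrt_le_sqrt
      exact Finset.single_le_sum (f := fun j => (fderiv ℝ φ q (bv j) - fderiv ℝ φ p1 (bv j)) ^ 2)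
        (fun _ _ => sq_nonneg _) (Finset.mem_univ j)
    calc ‖F q - F p1‖ ^ 2 ≤ _ := by gcongr
      _ = _ := Real.sq_sqrt (Finset.sum_nonneg fun _ _ => sq_nonneg _)
  calc _ = ((2 * (k : ℝ))⁻¹ * ‖q - p1‖) ^ 2 := by rw [mul_pow]
    _ ≤ ‖F q - F p1‖ ^ 2 := by gcongr
    _ ≤ _ := h7

lemma grad_lower {J : Type*} [Fintype J] (α β X Y Z : J → ℝ) (s c0 M κ2 r : ℝ) (hc0 : 0 < c0)
    (hM : 0 ≤ M) (hαβ : c0 ≤ ∑ j, (α j - β j) ^ 2) (hα : ∑ j, α j ^ 2 ≤ M)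
    (hr : r ^ 2 = ∑ j, X j ^ 2) (hsr : |s| + r = 1)
    (hYZ : ∑ j, Y j ^ 2 + ∑ j, Z j ^ 2 ≤ κ2) :
    1 ≤ (6 + 4 * (2 + 6 * M) / c0) *
      (∑ j, (s * α j + (X j - Y j)) ^ 2 + ∑ j, (s * β j + (X j - Z j)) ^ 2 + κ2) := by
  set PA := ∑ j, (s * α j + (X j - Y j)) ^ 2 with hPA
  set PB := ∑ j, (s * β j + (X j - Z j)) ^ 2 with hPB
  have e1 : s ^ 2 * ∑ j, (α j - β j) ^ 2 ≤ 4 * (PA + PB + (∑ j, Y j ^ 2 + ∑ j, Z j ^ 2)) := by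
    rw [hPA, hPB, ← Finset.sum_add_distrib, ← Finset.sum_add_distrib, ← Finset.sum_add_distrib,
      Finset.mul_sum, Finset.mul_sum]
    refine Finset.sum_le_sum fun j _ => ?_
    set A := s * α j + (X j - Y j) with hA
    set B := s * β j + (X j - Z j) with hB
    have : s ^ 2 * (α j - β j) ^ 2 = (A - B + Y j - Z j) ^ 2 := by rw [hA, hB]; ring
    rw [this]
    nlinarith [sq_nonneg (A + B), sq_nonneg (A - Y j), sq_nonneg (A + Z j), sq_nonneg (B + Y j),
      sq_nonneg (B - Z j), sq_nonneg (Y j + Z j)]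
  have e2 : r ^ 2 ≤ 3 * (PA + s ^ 2 * (∑ j, α j ^ 2) + ∑ j, Y j ^ 2) := by
    rw [hr, hPA, Finset.mul_sum, ← Finset.sum_add_distrib, ← Finset.sum_add_distrib,
      Finset.mul_sum]
    refine Finset.sum_le_sum fun j _ => ?_
    set A := s * α j + (X j - Y j) with hA
    have : X j = A - s * α j + Y j := by rw [hA]; ring
    rw [this]
    nlinarith [sq_nonneg (A + s * α j), sq_nonneg (A - Y j), sq_nonneg (s * α j + Y j)]
  have hPB0 : 0 ≤ PB := Finset.sum_nonneg fun _ _ => sq_nonneg _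
  have hPA0 : 0 ≤ PA := Finset.sum_nonneg fun _ _ => sq_nonneg _
  have hY0 : 0 ≤ ∑ j, Y j ^ 2 := Finset.sum_nonneg fun _ _ => sq_nonneg _
  have hZ0 : 0 ≤ ∑ j, Z j ^ 2 := Finset.sum_nonneg fun _ _ => sq_nonneg _
  set P := PA + PB + κ2 with hP
  have e3 : s ^ 2 ≤ 4 * P / c0 := by
    rw [le_div_iff₀ hc0]
    have : s ^ 2 * c0 ≤ s ^ 2 * ∑ j, (α j - β j) ^ 2 := by gcongr
    linarith
  have e4 : s ^ 2 * (∑ j, α j ^ 2) ≤ s ^ 2 * M := by gcongr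
  have e5 : 1 ≤ 2 * s ^ 2 + 2 * r ^ 2 := by
    have : 1 = (|s| + r) ^ 2 := by rw [hsr]; norm_num
    nlinarith [sq_nonneg (|s| - r), sq_abs s]
  have e6 : (2 + 6 * M) * s ^ 2 ≤ (2 + 6 * M) * (4 * P / c0) := by gcongr
  have e7 : (6 + 4 * (2 + 6 * M) / c0) * P = 6 * P + (2 + 6 * M) * (4 * P / c0) := by ring
  rw [e7]
  linarith

/-- linear phase -/
def ell (x y z : E d) : E d × E d →L[ℝ] ℝ :=
  (innerSL ℝ (x - y)).comp (ContinuousLinearMap.fst ℝ (E d) (E d)) +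
    (innerSL ℝ (x - z)).comp (ContinuousLinearMap.snd ℝ (E d) (E d))

lemma ell_apply (x y z : E d) (p : E d × E d) :
    ell x y z p = ⟪x - y, p.1⟫ + ⟪x - z, p.2⟫ := rfl

lemma ell_eta (x y z : E d) (j : Fin d) : ell x y z (etaV j) = x j - y j := by
  simp [ell_apply, etaV, ev, EuclideanSpace.inner_single_right]

lemma ell_xi (x y z : E d) (j : Fin d) : ell x y z (xiV j) = x j - z j := by
  simp [ell_apply, xiV, ev, EuclideanSpace.inner_single_right]

end kern

section kern2
variable {d : ℕ}

/-- oscillatory kernel -/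
def kern (m : E d × E d → ℂ) (φ : E d × E d → ℝ) (lam : ℝ) (x y z : E d) : ℂ :=
  ∫ p : E d × E d, Complex.exp (Complex.I * ((lam * φ p + ell x y z p : ℝ) : ℂ)) * m p

instance volEE : (volume : Measure (E d × E d)).IsAddHaarMeasure :=
  inferInstanceAs ((volume : Measure (E d)).prod (volume : Measure (E d))).IsAddHaarMeasure

set_option maxHeartbeats 2000000 in
lemma kern_caseA (φ : E d × E d → ℝ) (m : E d × E d → ℂ)
    (hφs : ContDiff ℝ (⊤ : ℕ∞) φ) (hφc : HasCompactSupport φ)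
    (hms : ContDiff ℝ (⊤ : ℕ∞) m) (hmc : HasCompactSupport m)
    (hgrad : ∀ p ∈ tsupport m, ∃ j : Fin d, fderiv ℝ φ p (etaV j - xiV j) ≠ 0) (N : ℕ) :
    ∃ κ : ℝ, 0 < κ ∧ ∃ C : ℝ, 0 ≤ C ∧ ∀ (lam : ℝ) (x y z : E d), 1 ≤ |lam| →
      ‖y‖ + ‖z‖ ≤ κ * (|lam| + ‖x‖) → (|lam| + ‖x‖) ^ N * ‖kern m φ lam x y z‖ ≤ C := by
  have hdc : ∀ v, Continuous (fun x => fderiv ℝ φ x v) := fun v =>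
    (hφs.continuous_fderiv (by simp)).clm_apply continuous_const
  obtain ⟨c0, hc0, hc0'⟩ := IsCompact.exists_forall_le' (f := fun p =>
      ∑ j, (fderiv ℝ φ p (etaV j) - fderiv ℝ φ p (xiV j)) ^ 2) hmc
    (continuous_finsetSum _ fun j _ => ((hdc _).sub (hdc _)).pow 2).continuousOn (a := 0) (by
      intro p hp
      obtain ⟨j, hj⟩ := hgrad p hp
      rw [map_sub] at hj
      exact Finset.sum_pos' (fun _ _ => sq_nonneg _) ⟨j, Finset.mem_univ _, by positivity⟩)
  obtain ⟨M0, hM0⟩ := IsCompact.exists_bound_of_continuousOn (f := fun p =>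
      ∑ j, (fderiv ℝ φ p (etaV (d := d) j)) ^ 2) hmc
    (continuous_finsetSum _ fun j _ => (hdc _).pow 2).continuousOn
  set M := max M0 0 with hM
  have hMn : 0 ≤ M := le_max_right _ _
  set Q := 6 + 4 * (2 + 6 * M) / c0 with hQ
  have hQ0 : 0 < Q := by positivity
  set κ := Real.sqrt (1 / (2 * Q)) with hκ
  have hκ0 : 0 < κ := Real.sqrt_pos.2 (by positivity)
  have hκ2 : κ ^ 2 = 1 / (2 * Q) := Real.sq_sqrt (by positivity)
  refine ⟨κ, hκ0, ?_⟩
  let ι := {q : ℝ × E d × E d × E d //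
    1 ≤ |q.1| ∧ ‖q.2.2.1‖ + ‖q.2.2.2‖ ≤ κ * (|q.1| + ‖q.2.1‖)}
  let mu : ι → ℝ := fun q => |q.1.1| + ‖q.1.2.1‖
  have hmu : ∀ q : ι, 1 ≤ mu q := fun q => by
    have := q.2.1
    have h2 := norm_nonneg q.1.2.1
    simp only [mu]; linarith
  let Ψ : ι → E d × E d → ℝ := fun q p =>
    (mu q)⁻¹ * (q.1.1 * φ p + ell q.1.2.1 q.1.2.2.1 q.1.2.2.2 p)
  have hΨs : ∀ q, ContDiff ℝ (⊤ : ℕ∞) (Ψ q) := fun q =>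
    contDiff_const.mul ((contDiff_const.mul hφs).add (ContinuousLinearMap.contDiff _))
  have hfd : ∀ q p v, fderiv ℝ (Ψ q) p v =
      ((mu q)⁻¹ * q.1.1) * fderiv ℝ φ p v + (mu q)⁻¹ * ell q.1.2.1 q.1.2.2.1 q.1.2.2.2 v := by
    intro q p v
    have h1 := (hφs.differentiable (by simp) p).hasFDerivAt
    have h2 := ((h1.const_mul q.1.1).add
      (ell q.1.2.1 q.1.2.2.1 q.1.2.2.2).hasFDerivAt).const_mul (mu q)⁻¹
    have h3 : fderiv ℝ (Ψ q) p = _ := h2.fderiv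
    rw [h3]
    simp
    ring
  have hcoord : ∀ (x : E d) j, |x j| ≤ ‖x‖ := fun x j => by
    have := PiLp.norm_apply_le x j
    simpa using this
  have hnm : ∀ (q : ι) (t B : ℝ), |t| ≤ mu q * B → ‖(mu q)⁻¹ * t‖ ≤ B := by
    intro q t B h
    have h1 : 0 < mu q := by linarith [hmu q]
    rw [norm_mul, norm_inv, Real.norm_of_nonneg h1.le, Real.norm_eq_abs, inv_mul_le_iff₀ h1]
    exact h
  have hbs : ∀ q : ι, ‖(mu q)⁻¹ * q.1.1‖ ≤ 1 := by
    intro q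
    apply hnm
    have h2 := norm_nonneg q.1.2.1
    simp only [mu]; linarith
  have hbl : ∀ (q : ι) j, ‖(mu q)⁻¹ * ell q.1.2.1 q.1.2.2.1 q.1.2.2.2 (bv j)‖ ≤ 1 + κ := by
    intro q j
    have h1 := hmu q
    have hq := q.2.2
    apply hnm
    have hx : ‖q.1.2.1‖ ≤ mu q := by
      have := abs_nonneg q.1.1
      simp only [mu]; linarith
    have hy : ‖q.1.2.2.1‖ + ‖q.1.2.2.2‖ ≤ κ * mu q := hq
    have n1 := norm_nonneg q.1.2.2.1
    have n2 := norm_nonneg q.1.2.2.2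
    rcases j with j | j
    · simp only [bv, Sum.elim_inl, ell_eta]
      refine (abs_sub _ _).trans ?_
      have := hcoord q.1.2.1 j
      have := hcoord q.1.2.2.1 j
      nlinarith
    · simp only [bv, Sum.elim_inr, ell_xi]
      refine (abs_sub _ _).trans ?_
      have := hcoord q.1.2.1 j
      have := hcoord q.1.2.2.2 j
      nlinarith
  obtain ⟨C, hC0, hC⟩ := nonstat (volume : Measure (E d × E d)) (ι := ι) bv Ψ hΨs
    (fun j => by
      simp only [hfd]
      exact ((BF.const 1 hbs).mul ((BF.of_compact hφs hφc).dir (bv j))).add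
        (BF.const (1 + κ) (fun q => hbl q j)))
    hmc (c := 1 / (2 * Q)) (by positivity) N (fun _ => m) (BF.of_compact hms hmc)
    (fun _ => subset_rfl) (by
      intro q p hp
      have h1 := hmu q
      have hmu0 : 0 < mu q := by linarith
      have key := grad_lower (fun j => fderiv ℝ φ p (etaV j)) (fun j => fderiv ℝ φ p (xiV j))
        (fun j => (mu q)⁻¹ * q.1.2.1 j) (fun j => (mu q)⁻¹ * q.1.2.2.1 j)
        (fun j => (mu q)⁻¹ * q.1.2.2.2 j) ((mu q)⁻¹ * q.1.1) c0 M (κ ^ 2)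
        ((mu q)⁻¹ * ‖q.1.2.1‖) hc0 hMn (hc0' p hp)
        (((le_abs_self _).trans (hM0 p hp)).trans (le_max_left _ _))
        (by
          simp only [mul_pow, ← Finset.mul_sum]
          rw [EuclideanSpace.real_norm_sq_eq])
        (by
          rw [abs_mul, abs_inv, abs_of_pos hmu0, ← mul_add]
          exact inv_mul_cancel₀ hmu0.ne')
        (by
          simp only [mul_pow, ← Finset.mul_sum]
          rw [← EuclideanSpace.real_norm_sq_eq, ← EuclideanSpace.real_norm_sq_eq, ← mul_add,
            inv_pow, inv_mul_le_iff₀ (by positivity)]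
          have hy : ‖q.1.2.2.1‖ + ‖q.1.2.2.2‖ ≤ κ * mu q := q.2.2
          have n1 := norm_nonneg q.1.2.2.1
          have n2 := norm_nonneg q.1.2.2.2
          calc ‖q.1.2.2.1‖ ^ 2 + ‖q.1.2.2.2‖ ^ 2 ≤ (‖q.1.2.2.1‖ + ‖q.1.2.2.2‖) ^ 2 := by nlinarith
            _ ≤ (κ * mu q) ^ 2 := by gcongr
            _ = _ := by ring)
      rw [Fintype.sum_sum_type]
      simp only [hfd, bv, Sum.elim_inl, Sum.elim_inr, ell_eta, ell_xi]
      simp only [← mul_sub] at key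
      rw [← hQ, hκ2] at key
      set S1 := ∑ j, ((mu q)⁻¹ * q.1.1 * fderiv ℝ φ p (etaV j) +
        (mu q)⁻¹ * (q.1.2.1 j - q.1.2.2.1 j)) ^ 2
      set S2 := ∑ j, ((mu q)⁻¹ * q.1.1 * fderiv ℝ φ p (xiV j) +
        (mu q)⁻¹ * (q.1.2.1 j - q.1.2.2.2 j)) ^ 2
      have h5 : Q * (S1 + S2 + 1 / (2 * Q)) = Q * (S1 + S2) + 1 / 2 := by field_simp
      rw [h5] at key
      rw [div_le_iff₀ (by positivity)]
      linarith)
  refine ⟨C, hC0, fun lam x y z hlam hyz => ?_⟩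
  have := hC ⟨(lam, x, y, z), hlam, hyz⟩ (|lam| + ‖x‖)
  have hpos : 0 < |lam| + ‖x‖ := by positivity
  have h6 : ∀ p, (|lam| + ‖x‖) * Ψ ⟨(lam, x, y, z), hlam, hyz⟩ p = lam * φ p + ell x y z p := by
    intro p
    simp only [Ψ, mu]
    field_simp
  simp only [h6] at this
  rwa [abs_of_pos hpos] at this

lemma finrank_EE : Module.finrank ℝ (E d × E d) = d + d := by
  simp

lemma japan_ge (x : E d) : 1 ≤ Real.sqrt (1 + ‖x‖ ^ 2) := by
  rw [Real.one_le_sqrt]; nlinarith [sq_nonneg ‖x‖]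

lemma japan_pow (x : E d) (a : ℝ) : (1 + ‖x‖ ^ 2) ^ (a / 2) = (Real.sqrt (1 + ‖x‖ ^ 2)) ^ a := by
  rw [Real.sqrt_eq_rpow, ← Real.rpow_mul (by positivity)]
  congr 1; ring

theorem kern_bound (φ : E d × E d → ℝ) (m : E d × E d → ℂ)
    (a b : ℝ) (ha : 0 ≤ a) (hb : 0 ≤ b)
    (hφs : ContDiff ℝ (⊤ : ℕ∞) φ) (hφc : HasCompactSupport φ)
    (hms : ContDiff ℝ (⊤ : ℕ∞) m) (hmc : HasCompactSupport m)
    (hHess : ∀ p ∈ tsupport m, (hessMat φ p).det ≠ 0)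
    (hgrad : ∀ p ∈ tsupport m, ∃ j : Fin d, fderiv ℝ φ p (etaV j - xiV j) ≠ 0) :
    ∃ C : ℝ, 0 ≤ C ∧ ∀ (lam : ℝ) (x y z : E d), 1 ≤ |lam| →
      (1 + ‖x‖ ^ 2) ^ (a / 2) * ‖kern m φ lam x y z‖ ≤
        C * |lam| ^ (-(d : ℝ) - b) *
          ((1 + ‖y‖ ^ 2) ^ ((a + b) / 2) * (1 + ‖z‖ ^ 2) ^ ((a + b) / 2)) := by
  obtain ⟨N, hN⟩ := exists_nat_ge (a + (d + b))
  obtain ⟨κ, hκ, C1, hC10, hC1⟩ := kern_caseA φ m hφs hφc hms hmc hgrad N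
  obtain ⟨C2, hC20, hC2⟩ := statphase (volume : Measure (E d × E d)) bv hφs hφc hms hmc
    (fun p hp => hess_local hφs p (hHess p hp))
  refine ⟨C1 + C2 * (2 / κ) ^ (a + b), by positivity, fun lam x y z hlam => ?_⟩
  simp only [japan_pow]
  set Jx := Real.sqrt (1 + ‖x‖ ^ 2) with hJx
  set Jy := Real.sqrt (1 + ‖y‖ ^ 2) with hJy
  set Jz := Real.sqrt (1 + ‖z‖ ^ 2) with hJz
  have hx1 : 1 ≤ Jx := japan_ge x
  have hy1 : 1 ≤ Jy := japan_ge y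
  have hz1 : 1 ≤ Jz := japan_ge z
  set μ := |lam| + ‖x‖ with hμ
  have hμ1 : 1 ≤ μ := by have := norm_nonneg x; linarith
  have hxμ : Jx ≤ μ := by
    rw [hJx, Real.sqrt_le_left (by linarith)]
    nlinarith [norm_nonneg x]
  have hlμ : |lam| ≤ μ := by have := norm_nonneg x; linarith
  have hl0 : 0 < |lam| := by linarith
  have hyn : ‖y‖ ≤ Jy := Real.le_sqrt_of_sq_le (by linarith)
  have hzn : ‖z‖ ≤ Jz := Real.le_sqrt_of_sq_le (by linarith)
  have hyz1 : 1 ≤ Jy ^ (a + b) * Jz ^ (a + b) :=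
    one_le_mul_of_one_le_of_one_le (Real.one_le_rpow hy1 (by positivity))
      (Real.one_le_rpow hz1 (by positivity))
  have hL : 0 < |lam| ^ (-(d : ℝ) - b) := Real.rpow_pos_of_pos hl0 _
  have hLinv : |lam| ^ ((d : ℝ) + b) * |lam| ^ (-(d : ℝ) - b) = 1 := by
    rw [← Real.rpow_add hl0]; ring_nf; simp
  by_cases hcase : ‖y‖ + ‖z‖ ≤ κ * μ
  · have h1 := hC1 lam x y z hlam hcase
    set X := ‖kern m φ lam x y z‖
    have hX0 : 0 ≤ X := norm_nonneg _
    have h2 : Jx ^ a * |lam| ^ ((d : ℝ) + b) ≤ μ ^ N := by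
      calc Jx ^ a * |lam| ^ ((d : ℝ) + b) ≤ μ ^ a * μ ^ ((d : ℝ) + b) := by gcongr
        _ = μ ^ (a + (d + b)) := by rw [← Real.rpow_add (by linarith)]
        _ ≤ μ ^ (N : ℝ) := Real.rpow_le_rpow_of_exponent_le hμ1 hN
        _ = μ ^ N := Real.rpow_natCast _ _
    calc Jx ^ a * X = (Jx ^ a * |lam| ^ ((d : ℝ) + b)) * X * |lam| ^ (-(d : ℝ) - b) := by
          rw [show Jx ^ a * |lam| ^ ((d : ℝ) + b) * X * |lam| ^ (-(d : ℝ) - b) =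
            Jx ^ a * X * (|lam| ^ ((d : ℝ) + b) * |lam| ^ (-(d : ℝ) - b)) by ring, hLinv, mul_one]
      _ ≤ μ ^ N * X * |lam| ^ (-(d : ℝ) - b) := by gcongr
      _ ≤ C1 * |lam| ^ (-(d : ℝ) - b) := by gcongr
      _ ≤ (C1 + C2 * (2 / κ) ^ (a + b)) * |lam| ^ (-(d : ℝ) - b) := by
          gcongr
          have : 0 ≤ C2 * (2 / κ) ^ (a + b) := by positivity
          linarith
      _ ≤ _ := le_mul_of_one_le_right (by positivity) hyz1
  · push Not at hcase
    have h1 := hC2 lam (by intro h0; simp [h0] at hl0) (ell x y z)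
    change ‖kern m φ lam x y z‖ ≤ _ at h1
    set X := ‖kern m φ lam x y z‖
    have hX0 : 0 ≤ X := norm_nonneg _
    have h2 : Real.sqrt ((|lam| ^ (Module.finrank ℝ (E d × E d)))⁻¹) = |lam| ^ (-(d : ℝ)) := by
      rw [finrank_EE, pow_add, ← pow_two, Real.sqrt_inv, Real.sqrt_sq (by positivity),
        Real.rpow_neg hl0.le, Real.rpow_natCast]
    rw [h2] at h1
    have hμ2 : μ ≤ (2 / κ) * (Jy * Jz) := by
      have : κ * μ ≤ 2 * (Jy * Jz) := by nlinarith
      rw [div_mul_eq_mul_div, le_div_iff₀ hκ]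
      linarith
    have h3 : Jx ^ a * |lam| ^ b ≤ (2 / κ) ^ (a + b) * (Jy ^ (a + b) * Jz ^ (a + b)) := by
      calc Jx ^ a * |lam| ^ b ≤ μ ^ a * μ ^ b := by gcongr
        _ = μ ^ (a + b) := by rw [← Real.rpow_add (by linarith)]
        _ ≤ ((2 / κ) * (Jy * Jz)) ^ (a + b) := by gcongr
        _ = _ := by
          rw [Real.mul_rpow (by positivity) (by positivity),
            Real.mul_rpow (by positivity) (by positivity)]
    have h4 : |lam| ^ (-(d : ℝ)) = |lam| ^ b * |lam| ^ (-(d : ℝ) - b) := by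
      rw [← Real.rpow_add hl0]; ring_nf
    calc Jx ^ a * X ≤ Jx ^ a * (C2 * |lam| ^ (-(d : ℝ))) := by gcongr
      _ = C2 * (Jx ^ a * |lam| ^ b) * |lam| ^ (-(d : ℝ) - b) := by rw [h4]; ring
      _ ≤ C2 * ((2 / κ) ^ (a + b) * (Jy ^ (a + b) * Jz ^ (a + b))) * |lam| ^ (-(d : ℝ) - b) := by
          gcongr
      _ = (C2 * (2 / κ) ^ (a + b)) * |lam| ^ (-(d : ℝ) - b) * (Jy ^ (a + b) * Jz ^ (a + b)) := by
          ring
      _ ≤ _ := by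
          gcongr
          linarith

end kern2

section fub
variable {d : ℕ}

lemma Bop_eq (m : E d × E d → ℂ) (φ : E d × E d → ℝ) (lam : ℝ)
    (hφs : Continuous φ) (hms : Continuous m) (hmc : HasCompactSupport m)
    (f g : 𝓢(E d, ℂ)) (x : E d) :
    Bop m φ lam f g x = (((2 * Real.pi) ^ (-(d : ℝ) / 2) : ℝ) : ℂ) ^ 3 *
      ∫ q : E d × E d, f q.1 * g q.2 * kern m φ lam x q.1 q.2 := by
  set cst : ℂ := (((2 * Real.pi) ^ (-(d : ℝ) / 2) : ℝ) : ℂ) with hcst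
  set H : E d × E d → E d × E d → ℂ := fun p q =>
    Complex.exp (Complex.I * ((⟪x, p.1 + p.2⟫ + lam * φ p : ℝ) : ℂ)) * m p *
      ((Complex.exp (-(Complex.I * ((⟪q.1, p.1⟫ : ℝ) : ℂ))) * f q.1) *
        (Complex.exp (-(Complex.I * ((⟪q.2, p.2⟫ : ℝ) : ℂ))) * g q.2)) with hH
  have hfc := f.continuous
  have hgc := g.continuous
  have hHc : Continuous (Function.uncurry H) := by
    have : Continuous fun r : (E d × E d) × (E d × E d) => H r.1 r.2 := by
      simp only [hH]
      fun_prop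
    exact this
  have hn1 : ∀ t : ℝ, ‖Complex.exp (-(Complex.I * (t : ℂ)))‖ = 1 := by
    intro t
    have := norm_osc (-t)
    rwa [Complex.ofReal_neg, mul_neg] at this
  have hint : Integrable (Function.uncurry H)
      ((volume : Measure (E d × E d)).prod (volume : Measure (E d × E d))) := by
    have h1 : Integrable m (volume : Measure (E d × E d)) :=
      hms.integrable_of_hasCompactSupport hmc
    have h2 : Integrable (fun q : E d × E d => f q.1 * g q.2) (volume : Measure (E d × E d)) :=
      f.integrable.mul_prod g.integrable
    refine (h1.mul_prod h2).mono hHc.aestronglyMeasurable (Eventually.of_forall ?_)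
    rintro ⟨p, q⟩
    simp only [Function.uncurry, hH, norm_mul, norm_osc, hn1, one_mul]
    exact le_rfl
  have h1 : ∀ p : E d × E d,
      Complex.exp (Complex.I * ((⟪x, p.1 + p.2⟫ + lam * φ p : ℝ) : ℂ)) *
        m p * FT (⇑f) p.1 * FT (⇑g) p.2 = cst ^ 2 * ∫ q, H p q := by
    intro p
    simp only [FT, hH]
    rw [integral_const_mul, ← hcst]
    have := integral_prod_mul (μ := (volume : Measure (E d))) (ν := (volume : Measure (E d)))
      (fun y => Complex.exp (-(Complex.I * ((⟪y, p.1⟫ : ℝ) : ℂ))) * f y)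
      (fun z => Complex.exp (-(Complex.I * ((⟪z, p.2⟫ : ℝ) : ℂ))) * g z)
    rw [Measure.volume_eq_prod, this]
    ring
  have h2 : ∀ q : E d × E d, ∫ p, H p q = f q.1 * g q.2 * kern m φ lam x q.1 q.2 := by
    intro q
    rw [kern, ← integral_const_mul]
    congr 1
    funext p
    simp only [hH]
    have e1 : ∀ a1 a2 a3 c1 c2 c3 : ℂ, Complex.exp a1 * c1 * (Complex.exp a2 * c2 *
        (Complex.exp a3 * c3)) = c2 * c3 * (Complex.exp (a1 + a2 + a3) * c1) := by
      intros; rw [Complex.exp_add, Complex.exp_add]; ring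
    rw [e1]
    congr 3
    rw [ell_apply, inner_sub_left, inner_sub_left, inner_add_right]
    push_cast
    ring
  rw [Bop, ← hcst]
  simp only [h1]
  rw [integral_const_mul, integral_integral_swap hint]
  simp only [h2]
  ring

end fub

/-- Weighted `L^1 × L^1 → L^∞` estimate: if `φ, m ∈ C_0^∞(ℝ^{2d})`,
`a, b ≥ 0`, `Hess φ` is invertible and `(∇_η - ∇_ξ)φ` non-vanishing on `supp m`, then for
`|λ| ≥ 1`, `‖B_λ(f,g)‖_{L^∞(⟨x⟩^a)} ≤ C |λ|^{-d-b} ‖f‖_{L^1(⟨x⟩^{a+b})} ‖g‖_{L^1(⟨x⟩^{a+b})}`. -/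
theorem statement5 {d : ℕ} (φ : E d × E d → ℝ) (m : E d × E d → ℂ)
    (a b : ℝ) (ha : 0 ≤ a) (hb : 0 ≤ b)
    (hφs : ContDiff ℝ (⊤ : ℕ∞) φ) (hφc : HasCompactSupport φ)
    (hms : ContDiff ℝ (⊤ : ℕ∞) m) (hmc : HasCompactSupport m)
    (hHess : ∀ p ∈ tsupport m, (hessMat φ p).det ≠ 0)
    (hgrad : ∀ p ∈ tsupport m, ∃ j : Fin d, fderiv ℝ φ p (etaV j - xiV j) ≠ 0) :
    ∃ C : ℝ, ∀ lam : ℝ, 1 ≤ |lam| → ∀ f g : 𝓢(E d, ℂ),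
      wLpNorm ⊤ a (Bop m φ lam f g) ≤
        ENNReal.ofReal (C * |lam| ^ (-(d : ℝ) - b)) *
          (wLpNorm 1 (a + b) (⇑f) * wLpNorm 1 (a + b) (⇑g)) := by
  obtain ⟨C, hC0, hC⟩ := kern_bound φ m a b ha hb hφs hφc hms hmc hHess hgrad
  set cst : ℝ := (2 * Real.pi) ^ (-(d : ℝ) / 2) with hcst
  have hcst0 : 0 ≤ cst := by positivity
  refine ⟨cst ^ 3 * C, fun lam hlam f g => ?_⟩
  have hL0 : 0 ≤ |lam| ^ (-(d : ℝ) - b) := by positivity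
  set wt : ℝ → E d → ℝ := fun a x => (1 + ‖x‖ ^ 2) ^ (a / 2) with hwt
  have hwt0 : ∀ a x, 0 ≤ wt a x := fun a x => by positivity
  have hwtc : ∀ a, Continuous (wt a) := fun a => by
    apply Continuous.rpow_const (by fun_prop)
    intro x
    left
    positivity
  unfold wLpNorm
  rw [eLpNorm_exponent_top, eLpNormEssSup]
  refine essSup_le_of_ae_le _ ?_
  refine Eventually.of_forall fun x => ?_
  rw [eLpNorm_one_eq_lintegral_enorm, eLpNorm_one_eq_lintegral_enorm]
  change ‖((wt a x : ℝ) : ℂ) * Bop m φ lam f g x‖ₑ ≤ _ * ((∫⁻ y, ‖((wt (a + b) y : ℝ) : ℂ) * f y‖ₑ) *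
    ∫⁻ z, ‖((wt (a + b) z : ℝ) : ℂ) * g z‖ₑ)
  have hfc := f.continuous
  have hgc := g.continuous
  have hmf : ∀ h : E d → ℂ, Continuous h →
      AEMeasurable (fun y => ‖((wt (a + b) y : ℝ) : ℂ) * h y‖ₑ) volume := fun h hh =>
    (((Complex.continuous_ofReal.comp (hwtc _)).mul hh).enorm).measurable.aemeasurable
  rw [← lintegral_prod_mul (hmf _ hfc) (hmf _ hgc), ← Measure.volume_eq_prod]
  rw [Bop_eq m φ lam hφs.continuous hms.continuous hmc, ← hcst, ← mul_assoc, ← integral_const_mul]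
  refine (enorm_integral_le_lintegral_enorm _).trans ?_
  rw [← lintegral_const_mul' _ _ ENNReal.ofReal_ne_top]
  refine lintegral_mono fun q => ?_
  have hE : ENNReal.ofReal (cst ^ 3 * C * |lam| ^ (-(d : ℝ) - b)) =
      ‖((cst ^ 3 * C * |lam| ^ (-(d : ℝ) - b) : ℝ) : ℂ)‖ₑ := by
    rw [← ofReal_norm, Complex.norm_real, Real.norm_of_nonneg (by positivity)]
  rw [hE, ← enorm_mul, ← enorm_mul, enorm_le_iff_norm_le]
  have hk := hC lam x q.1 q.2 hlam
  change wt a x * _ ≤ _ * (wt (a + b) q.1 * wt (a + b) q.2) at hk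
  simp only [norm_mul, norm_pow, Complex.norm_real, Real.norm_of_nonneg (hwt0 _ _),
    Real.norm_of_nonneg hcst0, Real.norm_of_nonneg hC0, Real.norm_of_nonneg hL0]
  calc wt a x * cst ^ 3 * (‖f q.1‖ * ‖g q.2‖ * ‖kern m φ lam x q.1 q.2‖) =
      cst ^ 3 * (‖f q.1‖ * ‖g q.2‖) * (wt a x * ‖kern m φ lam x q.1 q.2‖) := by ring
    _ ≤ cst ^ 3 * (‖f q.1‖ * ‖g q.2‖) *
        (C * |lam| ^ (-(d : ℝ) - b) * (wt (a + b) q.1 * wt (a + b) q.2)) := by gcongr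
    _ = _ := by ring
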